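/- arXiv:2402.08973 — 5 statements merged into one kernel-verified Lean document; each statement's English description precedes it below -/
import Mathlib

section
/- Let d, m be positive integers, ν ∈ (0,1), and let D : ℝ^d → ℝ^d, b : [0,∞) × ℝ^d × ℝ^d → ℝ^d, σ : [0,∞) × ℝ^d × ℝ^d → ℝ^{d×m} satisfy the generalized monotonicity condition with constants η > 1, L > 0 and function V. Let Δ > 0 with L·Δ < 2, let t ≥ 0 and a, c ∈ ℝ^d, and define H : ℝ^d → ℝ^d by H(x) = x − Δ·b(t,x,a) + c. Then for all x₁, x₂ ∈ ℝ^d one has ⟨x₁ − x₂, H(x₁) − H(x₂)⟩ ≥ (1 − LΔ/2)·|x₁ − x₂|². -/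
open scoped RealInnerProductSpace

/-- The Frobenius norm `|A| = sqrt(trace(AᵀA))` of a real `d × m` matrix. -/
noncomputable def frobNorm {d m : ℕ} (A : Matrix (Fin d) (Fin m) ℝ) : ℝ :=
  Real.sqrt (∑ i, ∑ j, (A i j) ^ 2)

/-- Under the generalized monotonicity condition with constants `η > 1`, `L > 0` and
function `V`, for `Δ > 0` with `LΔ < 2`, `t ≥ 0` and `a, c ∈ ℝ^d`, the map
`H(x) = x − Δ·b(t,x,a) + c` satisfies
`⟨x₁ − x₂, H(x₁) − H(x₂)⟩ ≥ (1 − LΔ/2)·|x₁ − x₂|²`. -/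
theorem stmt0 (d m : ℕ) (hd : 0 < d) (hm : 0 < m) (ν : ℝ) (hν0 : 0 < ν) (hν1 : ν < 1)
    (D : EuclideanSpace ℝ (Fin d) → EuclideanSpace ℝ (Fin d))
    (b : ℝ → EuclideanSpace ℝ (Fin d) → EuclideanSpace ℝ (Fin d) → EuclideanSpace ℝ (Fin d))
    (σ : ℝ → EuclideanSpace ℝ (Fin d) → EuclideanSpace ℝ (Fin d) → Matrix (Fin d) (Fin m) ℝ)
    (η L : ℝ) (hη : 1 < η) (hL : 0 < L)
    (V : EuclideanSpace ℝ (Fin d) → EuclideanSpace ℝ (Fin d) → ℝ)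
    (hVnonneg : ∀ x y, 0 ≤ V x y) (hV0 : ∀ x, V x x = 0)
    (hmono : ∀ t ≥ (0 : ℝ), ∀ x₁ x₂ y₁ y₂ : EuclideanSpace ℝ (Fin d),
      2 * ⟪(x₁ - x₂) - (D y₁ - D y₂), b t x₁ y₁ - b t x₂ y₂⟫
          + η * (frobNorm (σ t x₁ y₁ - σ t x₂ y₂)) ^ 2
        ≤ L * (‖x₁ - x₂‖ ^ 2 + ‖y₁ - y₂‖ ^ 2) - V x₁ x₂ + V y₁ y₂)
    (Δ : ℝ) (hΔ : 0 < Δ) (hLΔ : L * Δ < 2)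
    (t : ℝ) (ht : 0 ≤ t) (a c : EuclideanSpace ℝ (Fin d))
    (H : EuclideanSpace ℝ (Fin d) → EuclideanSpace ℝ (Fin d))
    (hH : ∀ x, H x = x - Δ • b t x a + c) :
    ∀ x₁ x₂ : EuclideanSpace ℝ (Fin d),
      ⟪x₁ - x₂, H x₁ - H x₂⟫ ≥ (1 - L * Δ / 2) * ‖x₁ - x₂‖ ^ 2 := by
  intro x₁ x₂
  have hb : 2 * ⟪x₁ - x₂, b t x₁ a - b t x₂ a⟫ ≤ L * ‖x₁ - x₂‖ ^ 2 := by
    have h := hmono t ht x₁ x₂ a a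
    simp only [sub_self, sub_zero, norm_zero, hV0] at h
    nlinarith [mul_nonneg (zero_le_one.trans hη.le)
      (sq_nonneg (frobNorm (σ t x₁ a - σ t x₂ a))), hVnonneg x₁ x₂]
  have hdiff : H x₁ - H x₂ = (x₁ - x₂) - Δ • (b t x₁ a - b t x₂ a) := by
    rw [hH, hH, smul_sub]
    abel
  rw [hdiff, inner_sub_right, real_inner_smul_right, real_inner_self_eq_norm_sq]
  linarith [mul_le_mul_of_nonneg_left hb hΔ.le]
end

section
/- Let d, m be positive integers, ν ∈ (0,1), and let D : ℝ^d → ℝ^d, b : [0,∞) × ℝ^d × ℝ^d → ℝ^d, σ : [0,∞) × ℝ^d × ℝ^d → ℝ^{d×m} satisfy the generalized monotonicity condition with constants η > 1, L > 0 and function V, and assume that for every t ≥ 0 and a ∈ ℝ^d the map x ↦ b(t,x,a) is continuous. Let Δ > 0 with L·Δ < 2, let M, and grid points t_n = nΔ. Then for every function φ : {−M,…,0} → ℝ^d and every sequence w : ℕ → ℝ^m there exists a unique sequence X : {n ∈ ℤ : n ≥ −M} → ℝ^d such that X_n = φ(n) for −M ≤ n ≤ 0 and, for every n ≥ 0, X_{n+1}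 = D(X_{n+1−M}) − D(X_{n−M}) + X_n + b(t_{n+1}, X_{n+1}, X_{n+1−M})·Δ + σ(t_n, X_n, X_{n−M})·w_n. -/
open scoped RealInnerProductSpace

/-- The product `A·w` of a `d × m` matrix with a vector `w ∈ ℝ^m`. -/
noncomputable def mulVecE {d m : ℕ} (A : Matrix (Fin d) (Fin m) ℝ)
    (w : EuclideanSpace ℝ (Fin m)) : EuclideanSpace ℝ (Fin d) :=
  (EuclideanSpace.equiv (Fin d) ℝ).symm (A.mulVec (EuclideanSpace.equiv (Fin m) ℝ w))

/-- Among the points of the convex hull of a finite set on which `G` is monotone, some point `x`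
solves the finitely many Minty inequalities `0 ≤ ⟪G z, z - x⟫`. -/
theorem exists_mem_convexHull_forall_inner_nonneg {E : Type*} [NormedAddCommGroup E]
    [InnerProductSpace ℝ E] (G : E → E) (s : Finset E) (hs : s.Nonempty)
    (hG : ∀ x ∈ s, ∀ y ∈ s, 0 ≤ ⟪G x - G y, x - y⟫) :
    ∃ x ∈ convexHull ℝ (s : Set E), ∀ z ∈ s, 0 ≤ ⟪G z, z - x⟫ := by
  classical
  by_contra! hcon
  let T : E → (s → ℝ) := fun x z => ⟪G z, (z : E) - x⟫
  have hTcont : Continuous T := by fun_prop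
  have hTconv : Convex ℝ (T '' convexHull ℝ (s : Set E)) := by
    rintro _ ⟨x, hx, rfl⟩ _ ⟨y, hy, rfl⟩ a c ha hc hac
    refine ⟨a • x + c • y, convex_convexHull ℝ _ hx hy ha hc hac, ?_⟩
    ext z
    simp only [T, inner_sub_right, inner_add_right, inner_smul_right, Pi.add_apply,
      Pi.smul_apply, smul_eq_mul]
    linear_combination (-⟪G z, (z : E)⟫) * hac
  have hTcomp : IsCompact (T '' convexHull ℝ (s : Set E)) :=
    (s.finite_toSet.isCompact_convexHull ℝ).image hTcont
  have hdisj : Disjoint (T '' convexHull ℝ (s : Set E)) (Set.Ici 0) := by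
    rw [Set.disjoint_left]
    rintro _ ⟨x, hx, rfl⟩ h0
    obtain ⟨z, hz, hneg⟩ := hcon x hx
    exact absurd (h0 ⟨z, hz⟩) (not_le.mpr hneg)
  obtain ⟨f, u, v, hfu, huv, hfv⟩ :=
    geometric_hahn_banach_compact_closed hTconv hTcomp (convex_Ici 0) isClosed_Ici hdisj
  have hv : v < 0 := by simpa using hfv 0 (Set.mem_Ici.mpr le_rfl)
  let p : s → ℝ := fun i => f (Pi.single i 1)
  have hp : ∀ i, 0 ≤ p i := by
    intro i
    by_contra! hi
    have h := hfv ((v / p i) • Pi.single i 1) <| Set.mem_Ici.mpr <|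
      smul_nonneg (div_nonneg_of_nonpos hv.le hi.le) (Pi.single_nonneg.mpr zero_le_one)
    rw [map_smul, smul_eq_mul, div_mul_cancel₀ _ hi.ne] at h
    exact lt_irrefl _ h
  have hf : ∀ g : s → ℝ, f g = ∑ i, p i * g i := by
    intro g
    conv_lhs => rw [pi_eq_sum_univ' g]
    rw [map_sum]
    refine Finset.sum_congr rfl fun i _ => ?_
    rw [map_smul, smul_eq_mul, mul_comm]
  have hneg : ∀ x ∈ convexHull ℝ (s : Set E), ∑ i, p i * ⟪G i, (i : E) - x⟫ < 0 := by
    intro x hx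
    have h := hfu (T x) ⟨x, hx, rfl⟩
    rw [hf] at h
    exact h.trans (huv.trans hv)
  have hP : 0 < ∑ i, p i := by
    refine (Finset.sum_nonneg fun i _ => hp i).lt_of_ne fun h => ?_
    have hzero := (Finset.sum_eq_zero_iff_of_nonneg fun i _ => hp i).mp h.symm
    obtain ⟨x, hx⟩ := hs
    have h' := hneg x (subset_convexHull ℝ _ hx)
    rw [Finset.sum_eq_zero fun i hi => by rw [hzero i hi, zero_mul]] at h'
    exact lt_irrefl _ h'
  have hbary := hneg (Finset.univ.centerMass p fun i : s => (i : E)) <|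
    Finset.univ.centerMass_mem_convexHull (fun i _ => hp i) hP fun i _ => i.2
  have hdouble : (∑ i, p i) *
      ∑ i, p i * ⟪G i, (i : E) - Finset.univ.centerMass p fun i : s => (i : E)⟫ =
      ∑ i : s, ∑ j : s, p i * p j * ⟪G i, (i : E) - j⟫ := by
    rw [Finset.mul_sum]
    refine Finset.sum_congr rfl fun i _ => ?_
    simp only [Finset.centerMass, inner_sub_right, inner_smul_right, inner_sum]
    rw [mul_left_comm, mul_sub, mul_inv_cancel_left₀ hP.ne', Finset.sum_mul,
      ← Finset.sum_sub_distrib, Finset.mul_sum]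
    exact Finset.sum_congr rfl fun j _ => by ring
  have hsymm : 0 ≤ (∑ i : s, ∑ j : s, p i * p j * ⟪G i, (i : E) - j⟫) +
      ∑ i : s, ∑ j : s, p i * p j * ⟪G i, (i : E) - j⟫ := by
    nth_rewrite 2 [Finset.sum_comm]
    simp only [← Finset.sum_add_distrib]
    refine Finset.sum_nonneg fun i _ => Finset.sum_nonneg fun j _ => ?_
    have h := mul_nonneg (mul_nonneg (hp i) (hp j)) (hG i i.2 j j.2)
    simp only [inner_sub_left, inner_sub_right] at h ⊢
    linarith
  nlinarith

/-- A continuous monotone map admits a solution of the variational inequality on every closed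
ball around the origin. -/
theorem exists_mem_closedBall_forall_inner_nonneg {E : Type*} [NormedAddCommGroup E]
    [InnerProductSpace ℝ E] [ProperSpace E] (G : E → E) (hcont : Continuous G)
    (hG : ∀ x y, 0 ≤ ⟪G x - G y, x - y⟫) {R : ℝ} (hR : 0 ≤ R) :
    ∃ x ∈ Metric.closedBall (0 : E) R, ∀ z ∈ Metric.closedBall (0 : E) R,
      0 ≤ ⟪G x, z - x⟫ := by
  classical
  have hminty : (Metric.closedBall (0 : E) R ∩
      ⋂ z : Metric.closedBall (0 : E) R, {x | 0 ≤ ⟪G z, (z : E) - x⟫}).Nonempty := by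
    refine (isCompact_closedBall 0 R).inter_iInter_nonempty _
      (fun z => isClosed_le continuous_const (by fun_prop)) fun u => ?_
    obtain ⟨x, hx, hxz⟩ := exists_mem_convexHull_forall_inner_nonneg G
      (insert 0 (u.image Subtype.val)) (Finset.insert_nonempty _ _) fun x _ y _ => hG x y
    refine ⟨x, ?_, Set.mem_iInter₂.mpr fun z hz => hxz z <|
      Finset.mem_insert_of_mem (Finset.mem_image_of_mem _ hz)⟩
    refine convexHull_min (fun y hy => ?_) (convex_closedBall 0 R) hx
    rcases Finset.mem_insert.mp (Finset.mem_coe.mp hy) with rfl | hy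
    · exact Metric.mem_closedBall_self hR
    · obtain ⟨z, -, rfl⟩ := Finset.mem_image.mp hy
      exact z.2
  obtain ⟨x, hx, hxz⟩ := hminty
  refine ⟨x, hx, fun z hz => ?_⟩
  have hpos : ∀ t ∈ Set.Ioc (0 : ℝ) 1, 0 ≤ ⟪G (x + t • (z - x)), z - x⟫ := by
    intro t ht
    have hmem : x + t • (z - x) ∈ Metric.closedBall (0 : E) R :=
      (convex_closedBall 0 R).add_smul_sub_mem hx hz ⟨ht.1.le, ht.2⟩
    have h : 0 ≤ ⟪G (x + t • (z - x)), x + t • (z - x) - x⟫ :=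
      Set.mem_iInter.mp hxz ⟨_, hmem⟩
    rw [add_sub_cancel_left, inner_smul_right] at h
    exact nonneg_of_mul_nonneg_right h ht.1
  have hlim : Filter.Tendsto (fun t : ℝ => ⟪G (x + t • (z - x)), z - x⟫)
      (nhdsWithin 0 (Set.Ioi 0)) (nhds ⟪G x, z - x⟫) := by
    have hc : Continuous fun t : ℝ => ⟪G (x + t • (z - x)), z - x⟫ := by fun_prop
    simpa using (hc.tendsto 0).mono_left nhdsWithin_le_nhds
  refine ge_of_tendsto hlim ?_
  filter_upwards [Ioc_mem_nhdsGT (zero_lt_one' ℝ)] with t ht using hpos t ht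

/-- **Browder–Minty** in a proper inner product space, for strongly monotone maps. -/
theorem bijective_of_continuous_of_stronglyMonotone {E : Type*} [NormedAddCommGroup E]
    [InnerProductSpace ℝ E] [ProperSpace E] (F : E → E) (hcont : Continuous F) {c : ℝ}
    (hc : 0 < c) (hF : ∀ x y, c * ‖x - y‖ ^ 2 ≤ ⟪F x - F y, x - y⟫) :
    Function.Bijective F := by
  refine ⟨fun x y hxy => ?_, fun y => ?_⟩
  · have h := hF x y
    rw [hxy, sub_self, inner_zero_left] at h
    have h0 : ‖x - y‖ ^ 2 = 0 :=
      le_antisymm (nonpos_of_mul_nonpos_right h hc) (sq_nonneg _)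
    exact sub_eq_zero.mp (norm_eq_zero.mp (pow_eq_zero_iff two_ne_zero |>.mp h0))
  · let R : ℝ := ‖y - F 0‖ / c + 1
    have hR : 0 < R := by positivity
    obtain ⟨x, -, hxz⟩ := exists_mem_closedBall_forall_inner_nonneg (fun x => F x - y)
      (hcont.sub continuous_const)
      (fun a d => by
        rw [sub_sub_sub_cancel_right]
        exact (by positivity : 0 ≤ c * ‖a - d‖ ^ 2).trans (hF a d)) hR.le
    have hnorm : ‖x‖ < R := by
      have h1 := hxz 0 (Metric.mem_closedBall_self hR.le)
      have h2 := hF x 0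
      have h3 := real_inner_le_norm (y - F 0) x
      simp only [zero_sub, sub_zero, inner_neg_right, inner_sub_left] at h1 h2 h3
      have h4 : c * ‖x‖ ≤ ‖y - F 0‖ := by
        rcases (norm_nonneg x).eq_or_lt with h | h
        · rw [← h, mul_zero]
          exact norm_nonneg _
        · refine le_of_mul_le_mul_right ?_ h
          linarith
      have h5 : ‖x‖ ≤ ‖y - F 0‖ / c := by rwa [le_div_iff₀ hc, mul_comm]
      exact h5.trans_lt (lt_add_one _)
    let ε : ℝ := (R - ‖x‖) / (‖F x - y‖ + 1)
    have hε : 0 < ε := div_pos (sub_pos.mpr hnorm) (by positivity)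
    have hmem : x - ε • (F x - y) ∈ Metric.closedBall (0 : E) R := by
      rw [mem_closedBall_zero_iff]
      have h1 : ‖ε • (F x - y)‖ ≤ R - ‖x‖ := by
        rw [norm_smul, Real.norm_of_nonneg hε.le, div_mul_eq_mul_div,
          div_le_iff₀ (by positivity)]
        exact mul_le_mul_of_nonneg_left (le_add_of_nonneg_right zero_le_one)
          (sub_pos.mpr hnorm).le
      linarith [norm_sub_le x (ε • (F x - y))]
    have h := hxz _ hmem
    rw [sub_sub_cancel_left, inner_neg_right, inner_smul_right, real_inner_self_eq_norm_sq] at h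
    have h0 : ‖F x - y‖ ^ 2 = 0 :=
      le_antisymm (nonpos_of_mul_nonpos_right (by linarith) hε) (sq_nonneg _)
    exact ⟨x, sub_eq_zero.mp (norm_eq_zero.mp (pow_eq_zero_iff two_ne_zero |>.mp h0))⟩

/-- The implicit equation `x = r + Δ f(x)` is uniquely solvable when `f` is continuous and
one-sided Lipschitz with constant `L / 2`, `L Δ < 2`. -/
theorem existsUnique_implicit_euler_step {E : Type*} [NormedAddCommGroup E]
    [InnerProductSpace ℝ E] [ProperSpace E] (f : E → E) (hcont : Continuous f) {L Δ : ℝ}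
    (hf : ∀ x y, 2 * ⟪x - y, f x - f y⟫ ≤ L * ‖x - y‖ ^ 2) (hΔ : 0 < Δ) (hLΔ : L * Δ < 2)
    (r : E) : ∃! x, x = r + Δ • f x := by
  have hbij := bijective_of_continuous_of_stronglyMonotone (fun x => x - Δ • f x)
    (by fun_prop) (c := 1 - L * Δ / 2) (by linarith) fun x y => by
      have h := mul_le_mul_of_nonneg_left (hf x y) hΔ.le
      have e : x - Δ • f x - (y - Δ • f y) = (x - y) - Δ • (f x - f y) := by
        rw [smul_sub]; abel
      rw [e, inner_sub_left, real_inner_smul_left, real_inner_self_eq_norm_sq,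
        real_inner_comm (x - y)]
      linarith
  simpa only [sub_eq_iff_eq_add] using hbij.existsUnique r

/-- A causal recursion on the integers with prescribed values on `k ≤ 0` has a solution. -/
theorem exists_int_forward_recursion {E : Type*} (φ : ℤ → E) (step : ℕ → (ℤ → E) → E)
    (hstep : ∀ (n : ℕ) (h h' : ℤ → E), (∀ k ≤ (n : ℤ), h k = h' k) → step n h = step n h') :
    ∃ Y : ℤ → E, (∀ k ≤ 0, Y k = φ k) ∧ ∀ n : ℕ, Y (n + 1) = step n Y := by
  let H : ℕ → ℤ → E := fun n =>
    Nat.rec φ (fun n h => Function.update h ((n : ℤ) + 1) (step n h)) n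
  have hsucc : ∀ n, H (n + 1) = Function.update (H n) ((n : ℤ) + 1) (step n (H n)) :=
    fun _ => rfl
  have hstable : ∀ (n : ℕ) (k : ℤ), k ≤ n → H n k = H k.toNat k := by
    intro n
    induction n with
    | zero =>
      intro k hk
      rw [Int.toNat_of_nonpos (by simpa using hk)]
    | succ n ih =>
      intro k hk
      rcases eq_or_ne k ((n : ℤ) + 1) with rfl | hne
      · rfl
      · rw [hsucc, Function.update_of_ne hne]
        exact ih k (by push_cast at hk; omega)
  refine ⟨fun k => H k.toNat k, fun k hk => ?_, fun n => ?_⟩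
  · simp only [Int.toNat_of_nonpos hk]
    rfl
  · change H (n + 1) ((n : ℤ) + 1) = _
    rw [hsucc, Function.update_self]
    exact hstep n _ _ (hstable n)

/-- Well-posedness of the backward Euler method: under the generalized monotonicity
condition (with `η > 1`, `L > 0`, `V`), continuity of `x ↦ b(t,x,a)`, and `LΔ < 2`,
for every initial data `φ` on `{−M,…,0}` and every sequence of increments `w` there is
a unique sequence `X` indexed by `{n ∈ ℤ : n ≥ −M}` with `X_n = φ(n)` for `−M ≤ n ≤ 0`
and satisfying the backward Euler recursion with grid `t_n = nΔ`. -/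
theorem stmt1 (d m : ℕ) (hd : 0 < d) (hm : 0 < m) (ν : ℝ) (hν0 : 0 < ν) (hν1 : ν < 1)
    (D : EuclideanSpace ℝ (Fin d) → EuclideanSpace ℝ (Fin d))
    (b : ℝ → EuclideanSpace ℝ (Fin d) → EuclideanSpace ℝ (Fin d) → EuclideanSpace ℝ (Fin d))
    (σ : ℝ → EuclideanSpace ℝ (Fin d) → EuclideanSpace ℝ (Fin d) → Matrix (Fin d) (Fin m) ℝ)
    (η L : ℝ) (hη : 1 < η) (hL : 0 < L)
    (V : EuclideanSpace ℝ (Fin d) → EuclideanSpace ℝ (Fin d) → ℝ)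
    (hVnonneg : ∀ x y, 0 ≤ V x y) (hV0 : ∀ x, V x x = 0)
    (hmono : ∀ t ≥ (0 : ℝ), ∀ x₁ x₂ y₁ y₂ : EuclideanSpace ℝ (Fin d),
      2 * ⟪(x₁ - x₂) - (D y₁ - D y₂), b t x₁ y₁ - b t x₂ y₂⟫
          + η * (frobNorm (σ t x₁ y₁ - σ t x₂ y₂)) ^ 2
        ≤ L * (‖x₁ - x₂‖ ^ 2 + ‖y₁ - y₂‖ ^ 2) - V x₁ x₂ + V y₁ y₂)
    (hbcont : ∀ t ≥ (0 : ℝ), ∀ a : EuclideanSpace ℝ (Fin d), Continuous fun x => b t x a)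
    (Δ : ℝ) (hΔ : 0 < Δ) (hLΔ : L * Δ < 2) (M : ℕ) (hM : 0 < M) :
    ∀ (φ : ℤ → EuclideanSpace ℝ (Fin d)) (w : ℕ → EuclideanSpace ℝ (Fin m)),
      ∃! X : {n : ℤ // -(M : ℤ) ≤ n} → EuclideanSpace ℝ (Fin d),
        (∀ n : {n : ℤ // -(M : ℤ) ≤ n}, n.1 ≤ 0 → X n = φ n.1) ∧
        (∀ n : ℕ,
          X ⟨(n : ℤ) + 1, by omega⟩
            = D (X ⟨(n : ℤ) + 1 - (M : ℤ), by omega⟩) - D (X ⟨(n : ℤ) - (M : ℤ), by omega⟩)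
              + X ⟨(n : ℤ), by omega⟩
              + Δ • b (((n : ℝ) + 1) * Δ) (X ⟨(n : ℤ) + 1, by omega⟩)
                  (X ⟨(n : ℤ) + 1 - (M : ℤ), by omega⟩)
              + mulVecE (σ ((n : ℝ) * Δ) (X ⟨(n : ℤ), by omega⟩)
                  (X ⟨(n : ℤ) - (M : ℤ), by omega⟩)) (w n)) := by
  intro φ w
  have hsolve : ∀ (n : ℕ) (a r : EuclideanSpace ℝ (Fin d)),
      ∃! x, x = r + Δ • b (((n : ℝ) + 1) * Δ) x a := by
    intro n a r
    have ht : (0 : ℝ) ≤ ((n : ℝ) + 1) * Δ := by positivity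
    refine existsUnique_implicit_euler_step (fun x => b (((n : ℝ) + 1) * Δ) x a)
      (hbcont _ ht a) (fun x y => ?_) hΔ hLΔ r
    have h := hmono _ ht x y a a
    simp only [sub_self, sub_zero, norm_zero, hV0, ne_eq, OfNat.ofNat_ne_zero,
      not_false_eq_true, zero_pow, add_zero] at h
    have hσ := mul_nonneg (zero_le_one.trans hη.le) (sq_nonneg
      (frobNorm (σ (((n : ℝ) + 1) * Δ) x a - σ (((n : ℝ) + 1) * Δ) y a)))
    linarith [hVnonneg x y]
  choose S hS hSuniq using hsolve
  let rhs : ℕ → (ℤ → EuclideanSpace ℝ (Fin d)) → EuclideanSpace ℝ (Fin d) := fun n h =>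
    D (h ((n : ℤ) + 1 - M)) - D (h ((n : ℤ) - M)) + h n
      + mulVecE (σ ((n : ℝ) * Δ) (h n) (h ((n : ℤ) - M))) (w n)
  obtain ⟨Y, hY0, hY⟩ := exists_int_forward_recursion φ
    (fun n h => S n (h ((n : ℤ) + 1 - M)) (rhs n h)) fun n h h' hh => by
      simp only [rhs]
      rw [hh _ (by omega : (n : ℤ) + 1 - M ≤ n), hh _ (by omega : (n : ℤ) - M ≤ n),
        hh _ le_rfl]
  refine ⟨fun n => Y n, ⟨fun n hn => hY0 n hn, fun n => ?_⟩, ?_⟩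
  · have h := hS n (Y ((n : ℤ) + 1 - M)) (rhs n Y)
    rw [← hY n] at h
    rw [add_right_comm]
    exact h
  · rintro X ⟨hX0, hX⟩
    have hagree : ∀ (N : ℕ) (k : {n : ℤ // -(M : ℤ) ≤ n}), k.1 ≤ N → X k = Y k := by
      intro N
      induction N with
      | zero =>
        intro k hk
        have hk0 : k.1 ≤ 0 := by simpa using hk
        rw [hX0 k hk0, hY0 k hk0]
      | succ N ih =>
        rintro ⟨k, hkM⟩ hk
        rcases eq_or_ne k ((N : ℤ) + 1) with rfl | hne
        · have h := hX N
          rw [add_right_comm, ih ⟨(N : ℤ) + 1 - M, by omega⟩ (by simp only; omega),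
            ih ⟨(N : ℤ) - M, by omega⟩ (by simp only; omega), ih ⟨(N : ℤ), by omega⟩ le_rfl] at h
          exact (hSuniq N _ (rhs N Y) _ h).trans (hY N).symm
        · exact ih ⟨k, hkM⟩ (by simp only at hk ⊢; omega)
    funext k
    exact hagree k.1.toNat k (Int.self_le_toNat _)
end

section
/- Let ν ∈ (0,1), τ > 0, Δ > 0 and c₁ > c₂ > 0, and define h₃ : [1,∞) → ℝ by h₃(C) = (1+ν)·(C^Δ − 1)/Δ − c₁ + (1+ν)·ν·((C^Δ − 1)/Δ)·C^τ + c₂·C^τ. Then h₃ is strictly increasing on [1,∞), there exists a unique C* ∈ (1, (c₁/c₂)^{1/τ}) with h₃(C*) = 0, and h₃(C) ≤ 0 for every C ∈ [1, C*]. -/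
/-- Root-finding step for the exponential stability of the backward Euler method:
`h₃(C) = (1+ν)(C^Δ − 1)/Δ − c₁ + (1+ν)ν((C^Δ − 1)/Δ)C^τ + c₂ C^τ` is strictly increasing
on `[1,∞)`, has a unique root `C* ∈ (1, (c₁/c₂)^{1/τ})`, and `h₃(C) ≤ 0` on `[1, C*]`. -/
theorem stmt9 (ν τ Δ c₁ c₂ : ℝ) (hν0 : 0 < ν) (hν1 : ν < 1) (hτ : 0 < τ) (hΔ : 0 < Δ)
    (hc₂ : 0 < c₂) (hc : c₂ < c₁)
    (h₃ : ℝ → ℝ)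
    (hh₃ : ∀ C ≥ 1, h₃ C = (1 + ν) * (C ^ Δ - 1) / Δ - c₁
      + (1 + ν) * ν * ((C ^ Δ - 1) / Δ) * C ^ τ + c₂ * C ^ τ) :
    StrictMonoOn h₃ (Set.Ici 1) ∧
    ∃ Cstar ∈ Set.Ioo 1 ((c₁ / c₂) ^ (1 / τ)), h₃ Cstar = 0 ∧
      (∀ C' ∈ Set.Ioo 1 ((c₁ / c₂) ^ (1 / τ)), h₃ C' = 0 → C' = Cstar) ∧
      ∀ C ∈ Set.Icc 1 Cstar, h₃ C ≤ 0 := by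
  have hmono : StrictMonoOn h₃ (Set.Ici 1) := by
    intro x hx y hy hxy
    have hx1 : (1 : ℝ) ≤ x := hx
    have hx0 : (0 : ℝ) ≤ x := by linarith
    rw [hh₃ x hx, hh₃ y hy]
    have hΔlt : x ^ Δ < y ^ Δ := Real.rpow_lt_rpow hx0 hxy hΔ
    have hτlt : x ^ τ < y ^ τ := Real.rpow_lt_rpow hx0 hxy hτ
    have hΔge : 1 ≤ x ^ Δ := Real.one_le_rpow hx1 hΔ.le
    have hquot : (x ^ Δ - 1) / Δ < (y ^ Δ - 1) / Δ := by gcongr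
    have hquot0 : 0 ≤ (x ^ Δ - 1) / Δ := div_nonneg (by linarith) hΔ.le
    have hfst : (1 + ν) * (x ^ Δ - 1) / Δ < (1 + ν) * (y ^ Δ - 1) / Δ := by gcongr
    have hsnd : (1 + ν) * ν * ((x ^ Δ - 1) / Δ) * x ^ τ
        ≤ (1 + ν) * ν * ((y ^ Δ - 1) / Δ) * y ^ τ := by
      have hy0 : 0 ≤ (y ^ Δ - 1) / Δ := hquot0.trans hquot.le
      gcongr
    have hthd : c₂ * x ^ τ < c₂ * y ^ τ := by gcongr
    linarith
  have hratio : 1 < c₁ / c₂ := (one_lt_div hc₂).2 hc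
  have hratio0 : 0 ≤ c₁ / c₂ := by linarith
  set B := (c₁ / c₂) ^ (1 / τ) with hB
  have hB1 : 1 < B := Real.one_lt_rpow hratio (by positivity)
  have hBτ : c₂ * B ^ τ = c₁ := by
    rw [hB, ← Real.rpow_mul hratio0, one_div_mul_cancel hτ.ne', Real.rpow_one,
      mul_div_cancel₀ _ hc₂.ne']
  have hcont : ContinuousOn h₃ (Set.Icc 1 B) := by
    refine ContinuousOn.congr (f := fun C => (1 + ν) * (C ^ Δ - 1) / Δ - c₁
      + (1 + ν) * ν * ((C ^ Δ - 1) / Δ) * C ^ τ + c₂ * C ^ τ) ?_ fun C hC => hh₃ C hC.1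
    have hpowΔ := Real.continuous_rpow_const hΔ.le
    have hpowτ := Real.continuous_rpow_const hτ.le
    fun_prop
  have hneg : h₃ 1 < 0 := by
    rw [hh₃ 1 le_rfl]
    simp only [Real.one_rpow, sub_self, mul_zero, zero_div]
    linarith
  have hpos : 0 < h₃ B := by
    have hBΔ : 0 < B ^ Δ - 1 := sub_pos.2 (Real.one_lt_rpow hB1 hΔ)
    have hB0 : 0 < B := by linarith
    have hfst : 0 < (1 + ν) * (B ^ Δ - 1) / Δ := by positivity
    have hsnd : 0 < (1 + ν) * ν * ((B ^ Δ - 1) / Δ) * B ^ τ := by positivity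
    rw [hh₃ B hB1.le]
    linarith
  obtain ⟨Cstar, hmem, hroot⟩ := intermediate_value_Ioo hB1.le hcont ⟨hneg, hpos⟩
  have hstar : Cstar ∈ Set.Ici (1 : ℝ) := hmem.1.le
  refine ⟨hmono, Cstar, hmem, hroot, fun C' hC' h => ?_, fun C hC => ?_⟩
  · exact hmono.injOn hC'.1.le hstar (h.trans hroot.symm)
  · exact (hmono.monotoneOn hC.1 hstar hC.2).trans hroot.le
end

section
/- Define b_ex : ℝ × ℝ → ℝ by b_ex(x,y) = −9x + (11/2)y − 11·(x + y/2)·|x + y/2| and σ_ex : ℝ × ℝ → ℝ by σ_ex(x,y) = x + sin y + |x + y/2|^{3/2}. Then there exists K > 0 such that for all x, y ∈ ℝ: (1 + x²)² · ( 2·(x + y/2)·b_ex(x,y) + 5·(σ_ex(x,y))² ) ≤ K·(1 + x⁶ + y⁶). -/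
/-- The drift of the stability test example. -/
noncomputable def b_ex (x y : ℝ) : ℝ :=
  -9 * x + (11 / 2) * y - 11 * (x + y / 2) * |x + y / 2|

/-- The diffusion of the stability test example. -/
noncomputable def σ_ex (x y : ℝ) : ℝ :=
  x + Real.sin y + |x + y / 2| ^ ((3 : ℝ) / 2)

theorem two_mul_b_ex_add_five_mul_sq_le (x y : ℝ) :
    2 * (x + y / 2) * b_ex x y + 5 * (σ_ex x y) ^ 2 ≤ 20 * (1 + x ^ 2 + y ^ 2) := by
  unfold b_ex σ_ex
  have hw : 0 ≤ |x + y / 2| := abs_nonneg _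
  have hsq : |x + y / 2| ^ 2 = (x + y / 2) ^ 2 := sq_abs _
  have hpow : (|x + y / 2| ^ ((3 : ℝ) / 2)) ^ 2 = |x + y / 2| ^ 3 := by
    rw [← Real.rpow_natCast, ← Real.rpow_mul hw, ← Real.rpow_natCast]
    norm_num
  have hsin : Real.sin y ^ 2 ≤ 1 := Real.sin_sq_le_one y
  generalize |x + y / 2| ^ ((3 : ℝ) / 2) = r at *
  generalize |x + y / 2| = w at *
  generalize Real.sin y = t at *
  have hcube : (x + y / 2) * (x + y / 2) * w = w ^ 3 := by
    rw [← sq, ← hsq]; ring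
  have hw3 : 0 ≤ w ^ 3 := by positivity
  have hdrift : 2 * (x + y / 2) * (-9 * x + 11 / 2 * y - 11 * (x + y / 2) * w)
      = -18 * x ^ 2 + 2 * x * y + 11 / 2 * y ^ 2 - 22 * w ^ 3 := by
    rw [← hcube]; ring
  rw [hdrift]
  nlinarith [sq_nonneg (x + t - r), sq_nonneg (x - t), sq_nonneg (x - y), sq_nonneg x,
    sq_nonneg y]

theorem sq_one_add_sq_mul_le (x y : ℝ) :
    (1 + x ^ 2) ^ 2 * (1 + x ^ 2 + y ^ 2) ≤ 8 * (1 + x ^ 6 + y ^ 6) := by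
  have hx : (1 + x ^ 2) ^ 3 ≤ 4 * (1 + x ^ 6) := by
    nlinarith [mul_nonneg (add_nonneg zero_le_one (sq_nonneg x)) (sq_nonneg (x ^ 2 - 1))]
  have hxy : ∀ a b : ℝ, 0 ≤ a → 0 ≤ b → a ^ 2 * b ≤ a ^ 3 + b ^ 3 := by
    intro a b ha hb
    nlinarith [mul_nonneg (add_nonneg ha hb) (sq_nonneg (a - b)), mul_nonneg ha (sq_nonneg b)]
  have h := hxy (1 + x ^ 2) (y ^ 2) (by positivity) (by positivity)
  have hy : 0 ≤ y ^ 6 := by positivity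
  nlinarith

/-- The Khasminskii-type coercivity condition with moment exponent `p* = 6`
for the stability test example. -/
theorem stmt15 :
    ∃ K > (0 : ℝ), ∀ x y : ℝ,
      (1 + x ^ 2) ^ 2 * (2 * (x + y / 2) * b_ex x y + 5 * (σ_ex x y) ^ 2)
        ≤ K * (1 + x ^ 6 + y ^ 6) := by
  refine ⟨160, by norm_num, fun x y => ?_⟩
  calc (1 + x ^ 2) ^ 2 * (2 * (x + y / 2) * b_ex x y + 5 * (σ_ex x y) ^ 2)
      ≤ (1 + x ^ 2) ^ 2 * (20 * (1 + x ^ 2 + y ^ 2)) := by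
        gcongr
        exact two_mul_b_ex_add_five_mul_sq_le x y
    _ ≤ 160 * (1 + x ^ 6 + y ^ 6) := by
        linarith [sq_one_add_sq_mul_le x y]
end

section
/- Define b_ex : ℝ × ℝ → ℝ by b_ex(x,y) = −9x + (11/2)y − 11·(x + y/2)·|x + y/2| and σ_ex : ℝ × ℝ → ℝ by σ_ex(x,y) = x + sin y + |x + y/2|^{3/2}. Then for all x₁, x₂, y₁, y₂ ∈ ℝ: 2·((x₁−x₂) + (1/2)(y₁−y₂))·(b_ex(x₁,y₁) − b_ex(x₂,y₂)) + (5/4)·(σ_ex(x₁,y₁) − σ_ex(x₂,y₂))² ≤ −(53/4)·(x₁−x₂)² + (41/4)·(y₁−y₂)². -/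
/-- The increment of `|z| ^ (3/2)` is controlled by the monotonicity of `z * |z|`. -/
theorem sq_sub_abs_rpow_three_halves_le (z w : ℝ) :
    (|z| ^ ((3 : ℝ) / 2) - |w| ^ ((3 : ℝ) / 2)) ^ 2 ≤ 2 * ((z - w) * (z * |z| - w * |w|)) := by
  have rpow_eq (t : ℝ) : |t| ^ ((3 : ℝ) / 2) = √|t| ^ 3 := by
    rw [Real.sqrt_eq_rpow, ← Real.rpow_natCast, ← Real.rpow_mul (abs_nonneg t)]
    norm_num
  rw [rpow_eq, rpow_eq]
  have hz : √|z| ^ 2 = |z| := Real.sq_sqrt (abs_nonneg z)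
  have hw : √|w| ^ 2 = |w| := Real.sq_sqrt (abs_nonneg w)
  have hp := Real.sqrt_nonneg |z|
  have hq := Real.sqrt_nonneg |w|
  generalize √|z| = p at *
  generalize √|w| = q at *
  have same_sign : (p ^ 3 - q ^ 3) ^ 2 ≤ 2 * ((p ^ 2 - q ^ 2) * (p ^ 4 - q ^ 4)) := by
    have h : 0 ≤ 2 * ((p + q) ^ 2 * (p ^ 2 + q ^ 2)) - (p ^ 2 + p * q + q ^ 2) ^ 2 := by
      ring_nf
      positivity
    linarith [mul_nonneg (sq_nonneg (p - q)) h]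
  have opposite_sign :
      (p ^ 3 - q ^ 3) ^ 2 ≤ 2 * ((p ^ 2 + q ^ 2) * (p ^ 4 + q ^ 4)) := by
    have h : 0 ≤ 2 * ((p ^ 2 + q ^ 2) * (p ^ 4 + q ^ 4)) - (p ^ 3 - q ^ 3) ^ 2 := by
      ring_nf
      positivity
    linarith
  rw [← hz, ← hw]
  rcases abs_choice z with h | h <;> rcases abs_choice w with h' | h' <;> rw [h] at hz <;>
    rw [h'] at hw
  · rw [← hz, ← hw]; linarith
  · rw [← hz, show w = -q ^ 2 by linarith]; linarith
  · rw [show z = -p ^ 2 by linarith, ← hw]; linarith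
  · rw [show z = -p ^ 2 by linarith, show w = -q ^ 2 by linarith]; linarith

theorem sq_sin_sub_sin_le (x y : ℝ) : (Real.sin x - Real.sin y) ^ 2 ≤ (x - y) ^ 2 := by
  rw [sq_le_sq, Real.sin_sub_sin, abs_mul, abs_mul, abs_two]
  have h₁ := Real.abs_sin_le_abs (x := (x - y) / 2)
  have h₂ := Real.abs_cos_le_one ((x + y) / 2)
  have h₃ : |(x - y) / 2| = |x - y| / 2 := by rw [abs_div, abs_two]
  nlinarith [mul_nonneg (abs_nonneg (Real.sin ((x - y) / 2))) (sub_nonneg.2 h₂)]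

/-- The stability monotonicity estimate for the test example, with
`ζ = 5/4`, yielding `−(53/4)(x₁−x₂)² + (41/4)(y₁−y₂)²`. -/
theorem stmt16 (x₁ x₂ y₁ y₂ : ℝ) :
    2 * ((x₁ - x₂) + (1 / 2) * (y₁ - y₂)) * (b_ex x₁ y₁ - b_ex x₂ y₂)
      + (5 / 4) * (σ_ex x₁ y₁ - σ_ex x₂ y₂) ^ 2
    ≤ -(53 / 4) * (x₁ - x₂) ^ 2 + (41 / 4) * (y₁ - y₂) ^ 2 := by
  have hr := sq_sub_abs_rpow_three_halves_le (x₁ + y₁ / 2) (x₂ + y₂ / 2)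
  have hs := sq_sin_sub_sin_le y₁ y₂
  unfold b_ex σ_ex
  generalize |x₁ + y₁ / 2| ^ ((3 : ℝ) / 2) = r₁ at *
  generalize |x₂ + y₂ / 2| ^ ((3 : ℝ) / 2) = r₂ at *
  generalize |x₁ + y₁ / 2| = a₁ at *
  generalize |x₂ + y₂ / 2| = a₂ at *
  generalize Real.sin y₁ = s₁ at *
  generalize Real.sin y₂ = s₂ at *
  linarith [sq_nonneg ((x₁ - x₂) - (y₁ - y₂)), sq_nonneg ((x₁ - x₂) - (s₁ - s₂)),
    sq_nonneg ((x₁ - x₂) - (r₁ - r₂)), sq_nonneg ((s₁ - s₂) - (r₁ - r₂)), sq_nonneg (r₁ - r₂)]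
end
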